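/- arXiv:math/9905168 — 2 statements merged into one kernel-verified Lean document; each statement's English description precedes it below -/
import Mathlib

section
/- If g is a non-trivial grouplike element of a finite-dimensional Hopf algebra A over a field k, then the trace of left multiplication by g on A is zero. -/
open TensorProduct

lemma pow_val_add_one {M : Type*} [Monoid M] {N : ℕ} [NeZero N] {x : M} (hx : x ^ N = 1)
    (i : ZMod N) : x ^ (i + 1).val = x ^ i.val * x := by
  rw [ZMod.val_add, ZMod.val_one_eq_one_mod, Nat.add_mod_mod, ← pow_eq_pow_mod _ hx, pow_succ]

/-- The sum `∑ ζ ^ i x ^ i` over a full period of exponents. -/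
noncomputable def cyclicSum {K B : Type*} [Field K] [Ring B] [Algebra K B] (N : ℕ) [NeZero N]
    (ζ : K) (x : B) : B :=
  ∑ i : ZMod N, ζ ^ i.val • x ^ i.val

section Algebra

variable {K B : Type*} [Field K] [Ring B] [Algebra K B] {N : ℕ} [NeZero N]

lemma smul_cyclicSum_mul {ζ : K} (hζ : ζ ^ N = 1) {x : B} (hx : x ^ N = 1) :
    ζ • (cyclicSum N ζ x * x) = cyclicSum N ζ x := by
  unfold cyclicSum
  rw [Finset.sum_mul, Finset.smul_sum,
    ← Equiv.sum_comp (Equiv.addRight (1 : ZMod N)) (fun i ↦ ζ ^ i.val • x ^ i.val)]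
  refine Finset.sum_congr rfl fun i _ ↦ ?_
  simp only [Equiv.coe_addRight, pow_val_add_one hζ, pow_val_add_one hx, smul_mul_assoc, smul_smul,
    mul_comm ζ]

lemma cyclicSum_mul_aeval {ζ : K} (hζ : ζ ^ N = 1) {x : B} (hx : x ^ N = 1)
    (P : Polynomial K) :
    cyclicSum N ζ x * Polynomial.aeval x P = P.eval ζ⁻¹ • cyclicSum N ζ x := by
  have hζ0 : ζ ≠ 0 := by
    rintro rfl
    simp [NeZero.ne N] at hζ
  have h1 : cyclicSum N ζ x * x = ζ⁻¹ • cyclicSum N ζ x := by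
    rw [eq_inv_smul_iff₀ hζ0, smul_cyclicSum_mul hζ hx]
  induction P using Polynomial.induction_on with
  | C a => simp [Algebra.algebraMap_eq_smul_one]
  | add p q hp hq => simp [mul_add, add_smul, hp, hq]
  | monomial n a h =>
    rw [pow_succ, ← mul_assoc, map_mul, Polynomial.aeval_X, ← mul_assoc, h, smul_mul_assoc, h1,
      smul_smul]
    simp

/-- If a family is independent after multiplying by each cyclic sum, then it generates a free
module over the cyclic group algebra. -/
lemma linearIndependent_pow_mul [IsAlgClosed K] {ι : Type*} [Fintype ι] {x : B} (hx : x ^ N = 1)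
    {a : ι → B}
    (ha : ∀ ζ : K, ζ ^ N = 1 → LinearIndependent K fun j ↦ cyclicSum N ζ x * a j) :
    LinearIndependent K fun p : ZMod N × ι ↦ x ^ p.1.val * a p.2 := by
  let Φ : (ZMod N × ι → K) →ₗ[K] B :=
    Fintype.linearCombination K fun p : ZMod N × ι ↦ x ^ p.1.val * a p.2
  let S : Module.End K (ZMod N × ι → K) :=
    LinearMap.funLeft K K fun p : ZMod N × ι ↦ (p.1 + 1, p.2)
  have hS (v) : x * Φ (S v) = Φ v := by
    simp only [Φ, S, Fintype.linearCombination_apply, LinearMap.funLeft_apply, Finset.mul_sum]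
    rw [← Equiv.sum_comp ((Equiv.addRight (1 : ZMod N)).prodCongr (Equiv.refl ι))
      (fun p : ZMod N × ι ↦ v p • (x ^ p.1.val * a p.2))]
    refine Finset.sum_congr rfl fun p _ ↦ ?_
    simp [Prod.map, pow_val_add_one hx, ← mul_assoc, ← pow_succ, ← pow_succ']
  have hxu : IsUnit x := IsUnit.of_pow_eq_one hx (NeZero.ne N)
  have hinv : ∀ v ∈ LinearMap.ker Φ, S v ∈ LinearMap.ker Φ := by
    intro v hv
    rw [LinearMap.mem_ker] at hv ⊢
    exact (hxu.mul_right_eq_zero).1 ((hS v).trans hv)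
  suffices hker : LinearMap.ker Φ = ⊥ from
    Fintype.linearIndependent_iff.2 fun v hv ↦
      congrFun (LinearMap.ker_eq_bot'.1 hker v hv)
  by_contra hne
  have : Nontrivial (LinearMap.ker Φ) := Submodule.nontrivial_iff_ne_bot.2 hne
  obtain ⟨μ, hμ⟩ := Module.End.exists_eigenvalue (S.restrict hinv)
  obtain ⟨⟨v, hv⟩, hvμ⟩ := hμ.exists_hasEigenvector
  have hSv : S v = μ • v := congrArg Subtype.val hvμ.apply_eq_smul
  have hv0 : v ≠ 0 := fun h ↦ hvμ.2 (Subtype.ext h)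
  have hstep (i : ZMod N) (j : ι) : v (i + 1, j) = μ * v (i, j) := congrFun hSv (i, j)
  have hnat (n : ℕ) (i : ZMod N) (j : ι) : v (i + n, j) = μ ^ n * v (i, j) := by
    induction n with
    | zero => simp
    | succ n ih => rw [Nat.cast_succ, ← add_assoc, hstep, ih, pow_succ', mul_assoc]
  have hval (i : ZMod N) (j : ι) : v (i, j) = μ ^ i.val * v (0, j) := by
    simpa using hnat i.val 0 j
  have hμN : μ ^ N = 1 := by
    obtain ⟨⟨i, j⟩, hij⟩ := Function.ne_iff.1 hv0
    have := hnat N i j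
    rw [ZMod.natCast_self, add_zero] at this
    exact mul_right_cancel₀ hij (by rw [one_mul]; exact this.symm)
  have hsum : ∑ j, v (0, j) • (cyclicSum N μ x * a j) = 0 := by
    rw [← LinearMap.mem_ker.1 hv]
    simp only [Φ, Fintype.linearCombination_apply, cyclicSum, Finset.sum_mul, Finset.smul_sum]
    rw [Fintype.sum_prod_type_right]
    refine Finset.sum_congr rfl fun j _ ↦ Finset.sum_congr rfl fun i _ ↦ ?_
    rw [hval i j, smul_mul_assoc, smul_smul, mul_comm]
  have hzero := Fintype.linearIndependent_iff.1 (ha μ hμN) _ hsum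
  exact hv0 (funext fun p ↦ by rw [← Prod.mk.eta (p := p), hval, hzero]; simp)

lemma exists_forall_linearIndependent_cyclicSum_mul [FiniteDimensional K B] {x : B}
    (hx : x ^ N = 1) {f : ℕ}
    (hf : ∀ ζ : K, ζ ^ N = 1 →
      f ≤ Module.finrank K (LinearMap.range (LinearMap.mulLeft K (cyclicSum N ζ x)))) :
    ∃ a : Fin f → B, ∀ ζ : K, ζ ^ N = 1 →
      LinearIndependent K fun j ↦ cyclicSum N ζ x * a j := by
  classical
  have h (ζ : K) : ∃ a : Fin f → B, ζ ^ N = 1 →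
      LinearIndependent K fun j ↦ cyclicSum N ζ x * a j := by
    by_cases hζ : ζ ^ N = 1
    · obtain ⟨w, hw⟩ := exists_linearIndependent_of_le_finrank (hf ζ hζ)
      choose a ha using fun j ↦ (w j).2
      refine ⟨a, fun _ ↦ ?_⟩
      have h := hw.map' (Submodule.subtype _) (Submodule.ker_subtype _)
      rwa [show Submodule.subtype _ ∘ w = fun j ↦ cyclicSum N ζ x * a j from funext fun j ↦ (ha j).symm] at h
    · exact ⟨0, fun h ↦ absurd h hζ⟩
  choose a ha using h
  let s : Finset K := Polynomial.nthRootsFinset N (1 : K)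
  have hs (ζ : K) : ζ ∈ s ↔ ζ ^ N = 1 := Polynomial.mem_nthRootsFinset (NeZero.pos N) _
  refine ⟨fun j ↦ ∑ ξ ∈ s, Polynomial.aeval x (Lagrange.basis s id ξ⁻¹) * a ξ j,
    fun ζ hζ ↦ ?_⟩
  convert ha ζ hζ using 2 with j
  rw [Finset.mul_sum, Finset.sum_eq_single_of_mem ζ ((hs ζ).2 hζ)]
  · have hmem : ζ⁻¹ ∈ s := (hs _).2 (by rw [inv_pow, hζ, inv_one])
    rw [← mul_assoc, cyclicSum_mul_aeval hζ hx,
      show (Lagrange.basis s id ζ⁻¹).eval ζ⁻¹ = 1 from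
        Lagrange.eval_basis_self (v := id) Function.injective_id.injOn hmem, one_smul]
  · intro ξ _ hξ
    have hmem : ζ⁻¹ ∈ s := (hs _).2 (by rw [inv_pow, hζ, inv_one])
    rw [← mul_assoc, cyclicSum_mul_aeval hζ hx,
      show (Lagrange.basis s id ξ⁻¹).eval ζ⁻¹ = 0 from
        Lagrange.eval_basis_of_ne (v := id) (fun h ↦ hξ (inv_injective h)) hmem,
      zero_smul, zero_mul]

/-- There is a free module over the cyclic group algebra whose rank is that of some cyclic sum. -/
lemma exists_linearIndependent_pow_mul [IsAlgClosed K] [FiniteDimensional K B] {x : B}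
    (hx : x ^ N = 1) :
    ∃ (ζ : K) (f : ℕ) (a : Fin f → B), ζ ^ N = 1 ∧
      Module.finrank K (LinearMap.range (LinearMap.mulLeft K (cyclicSum N ζ x))) = f ∧
      LinearIndependent K fun p : ZMod N × Fin f ↦ x ^ p.1.val * a p.2 := by
  obtain ⟨ζ, hζ, hmin⟩ := Set.exists_min_image {ζ : K | ζ ^ N = 1}
    (fun ζ ↦ Module.finrank K (LinearMap.range (LinearMap.mulLeft K (cyclicSum N ζ x))))
    ((Polynomial.nthRootsFinset N (1 : K)).finite_toSet.subset fun ζ hζ ↦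
      (Polynomial.mem_nthRootsFinset (NeZero.pos N) _).2 hζ) ⟨1, one_pow N⟩
  obtain ⟨a, ha⟩ := exists_forall_linearIndependent_cyclicSum_mul hx hmin
  exact ⟨ζ, _, a, hζ, rfl, linearIndependent_pow_mul hx ha⟩

end Algebra

lemma LinearIndependent.exists_dual_eq_single {K V ι : Type*} [Field K] [AddCommGroup V]
    [Module K V] [DecidableEq ι] {b : ι → V} (hb : LinearIndependent K b) (i : ι) :
    ∃ l : V →ₗ[K] K, ∀ j, l (b j) = if j = i then 1 else 0 := by
  obtain ⟨l, hl⟩ := LinearMap.exists_extend (Finsupp.lapply i ∘ₗ hb.repr)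
  refine ⟨l, fun j ↦ ?_⟩
  have := LinearMap.congr_fun hl ⟨b j, Submodule.subset_span ⟨j, rfl⟩⟩
  simp only [LinearMap.comp_apply, Submodule.subtype_apply] at this
  rw [this, hb.repr_eq_single j _ rfl, Finsupp.lapply_apply, Finsupp.single_apply]

section Hopf

variable {K A : Type*} [Field K] [Ring A] [HopfAlgebra K A]

open Coalgebra

/-- The Galois map `a ⊗ b ↦ Δ(a) (1 ⊗ b)`. -/
noncomputable def galoisMap (K A : Type*) [Field K] [Ring A] [HopfAlgebra K A] :
    A ⊗[K] A →ₗ[K] A ⊗[K] A :=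
  TensorProduct.lift ((LinearMap.mul K (A ⊗[K] A)).compl₁₂ (comul (R := K) (A := A))
    (TensorProduct.mk K A A 1))

@[simp]
lemma galoisMap_tmul (a b : A) :
    galoisMap K A (a ⊗ₜ b) = comul (R := K) a * (1 ⊗ₜ b) := rfl

lemma galoisMap_surjective : Function.Surjective (galoisMap K A) := by
  rw [← LinearMap.range_eq_top, eq_top_iff, ← TensorProduct.span_tmul_eq_top, Submodule.span_le]
  rintro _ ⟨a, m, rfl⟩
  let W : A ⊗[K] (A ⊗[K] A) →ₗ[K] A ⊗[K] A :=
    LinearMap.lTensor A (LinearMap.mulRight K m ∘ₗ LinearMap.mul' K A ∘ₗ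
      (HopfAlgebra.antipode K (A := A)).lTensor A)
  let V : A ⊗[K] A →ₗ[K] A ⊗[K] A :=
    LinearMap.lTensor A (LinearMap.mulRight K m ∘ₗ HopfAlgebra.antipode K (A := A))
  have h1 (u : A ⊗[K] A) (y : A) : W (TensorProduct.assoc K A A A (u ⊗ₜ y)) =
      u * (1 ⊗ₜ (HopfAlgebra.antipode K y * m)) := by
    induction u with
    | zero => simp
    | add u v hu hv => simp [TensorProduct.add_tmul, add_mul, hu, hv]
    | tmul b c => simp [W, mul_assoc]
  have h2 (z : A ⊗[K] A) :
      W (TensorProduct.assoc K A A A ((comul (R := K)).rTensor A z)) = galoisMap K A (V z) := by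
    induction z with
    | zero => simp
    | add u v hu hv => simp only [map_add, hu, hv]
    | tmul b c => simp [h1, V]
  have h3 (z : A ⊗[K] A) : W ((comul (R := K)).lTensor A z) =
      LinearMap.lTensor A (LinearMap.mulRight K m ∘ₗ Algebra.linearMap K A)
        ((counit (R := K)).lTensor A z) := by
    induction z with
    | zero => simp
    | add u v hu hv => simp only [map_add, hu, hv]
    | tmul b c => simp [W]
  refine ⟨V (comul a), ?_⟩
  rw [← h2, coassoc_apply, h3, lTensor_counit_comul]
  simp

lemma finrank_range_mulLeft_comul_le [FiniteDimensional K A] (t : A) :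
    Module.finrank K (LinearMap.range (LinearMap.mulLeft K (comul (R := K) t))) ≤
      Module.finrank K (LinearMap.range (LinearMap.mulLeft K t)) * Module.finrank K A := by
  have hcomm : LinearMap.mulLeft K (comul (R := K) t) ∘ₗ galoisMap K A =
      galoisMap K A ∘ₗ (LinearMap.range (LinearMap.mulLeft K t)).subtype.rTensor A ∘ₗ
        (LinearMap.mulLeft K t).rangeRestrict.rTensor A := by
    ext a b
    simp [mul_assoc]
  rw [← LinearMap.range_comp_of_range_eq_top _
    (LinearMap.range_eq_top.2 (galoisMap_surjective (K := K) (A := A))), hcomm,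
    ← LinearMap.comp_assoc, ← Module.finrank_tensorProduct]
  exact (Submodule.finrank_mono (LinearMap.range_comp_le_range _ _)).trans
    (LinearMap.finrank_range_le _)

/-- A free module over the cyclic group algebra of a grouplike, of rank equal to that of a cyclic
sum, is the whole Hopf algebra. -/
lemma span_pow_mul_eq_top [FiniteDimensional K A] {g : A} (hg : IsGroupLikeElem K g) {N : ℕ}
    [NeZero N] (hpow : LinearIndependent K fun i : ZMod N ↦ g ^ i.val) {ζ : K}
    {f : ℕ} {a : Fin f → A}
    (hf : Module.finrank K (LinearMap.range (LinearMap.mulLeft K (cyclicSum N ζ g))) = f)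
    (ha : LinearIndependent K fun p : ZMod N × Fin f ↦ g ^ p.1.val * a p.2) :
    Submodule.span K (Set.range fun p : ZMod N × Fin f ↦ g ^ p.1.val * a p.2) = ⊤ := by
  classical
  let d : A ⊗[K] A := comul (R := K) (cyclicSum N ζ g)
  have hd (y z : A) :
      d * (y ⊗ₜ z) = ∑ i : ZMod N, (ζ ^ i.val • (g ^ i.val * y)) ⊗ₜ[K] (g ^ i.val * z) := by
    simp only [d, cyclicSum, map_sum, map_smul, hg.pow.comul_eq_tmul_self, Finset.sum_mul,
      smul_mul_assoc, Algebra.TensorProduct.tmul_mul_tmul, TensorProduct.smul_tmul']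
  let Ψ : (Fin f → A) →ₗ[K] A ⊗[K] A :=
    LinearMap.mulLeft K d ∘ₗ ∑ j, (TensorProduct.mk K A A).flip (a j) ∘ₗ LinearMap.proj j
  have hΨ (y : Fin f → A) : Ψ y = ∑ p : ZMod N × Fin f,
      (ζ ^ p.1.val • (g ^ p.1.val * y p.2)) ⊗ₜ[K] (g ^ p.1.val * a p.2) := by
    simp [Ψ, hd, Fintype.sum_prod_type_right]
  have hinj : Function.Injective Ψ := by
    rw [← LinearMap.ker_eq_bot, LinearMap.ker_eq_bot']
    intro y hy
    funext j
    obtain ⟨l, hl⟩ := ha.exists_dual_eq_single (0, j)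
    rw [hΨ] at hy
    have := congrArg (TensorProduct.rid K A ∘ LinearMap.lTensor A l) hy
    simpa [hl] using this
  have hrange : LinearMap.range Ψ = LinearMap.range (LinearMap.mulLeft K d) := by
    apply Submodule.eq_of_le_of_finrank_le (LinearMap.range_comp_le_range _ _)
    rw [LinearMap.finrank_range_of_inj hinj, Module.finrank_pi_fintype]
    simpa [hf] using finrank_range_mulLeft_comul_le (K := K) (cyclicSum N ζ g)
  rw [eq_top_iff]
  intro z _
  obtain ⟨y, hy⟩ : d * (1 ⊗ₜ z) ∈ LinearMap.range Ψ := hrange ▸ ⟨1 ⊗ₜ z, rfl⟩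
  obtain ⟨l, hl⟩ := hpow.exists_dual_eq_single 0
  rw [hΨ, hd] at hy
  have := congrArg (TensorProduct.lid K A ∘ LinearMap.rTensor A l) hy
  simp only [Function.comp_apply, map_sum, LinearMap.rTensor_tmul, TensorProduct.lid_tmul,
    map_smul, mul_one, hl] at this
  have hz : z = ∑ p : ZMod N × Fin f,
      (ζ ^ p.1.val • l (g ^ p.1.val * y p.2)) • (g ^ p.1.val * a p.2) := by
    simpa using this.symm
  rw [hz]
  exact Submodule.sum_mem _ fun p _ ↦ Submodule.smul_mem _ _ (Submodule.subset_span ⟨p, rfl⟩)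

lemma IsGroupLikeElem.linearIndependent_pow [FiniteDimensional K A] {g : A}
    (hg : IsGroupLikeElem K g) (hne : g ≠ 1) :
    ∃ N : ℕ, 1 < N ∧ g ^ N = 1 ∧ LinearIndependent K fun i : ZMod N ↦ g ^ i.val := by
  let γ : GroupLike K A := ⟨g, hg⟩
  have hli := linearIndep_groupLikeVal (R := K) (A := A)
  have : Finite (GroupLike K A) := hli.finite
  have hγ : γ ≠ 1 := fun h ↦ hne (congrArg GroupLike.val h)
  have hpos : 0 < orderOf γ := orderOf_pos γ
  have : NeZero (orderOf γ) := ⟨hpos.ne'⟩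
  have h1 : orderOf γ ≠ 1 := fun h ↦ hγ (orderOf_eq_one_iff.1 h)
  refine ⟨orderOf γ, by omega, congrArg GroupLike.val (pow_orderOf_eq_one γ), ?_⟩
  exact hli.comp (fun i : ZMod (orderOf γ) ↦ γ ^ i.val) fun i j hij ↦
    ZMod.val_injective _ (pow_injOn_Iio_orderOf (ZMod.val_lt i) (ZMod.val_lt j) hij)

lemma IsGroupLikeElem.trace_mulLeft_eq_zero_of_isAlgClosed [IsAlgClosed K]
    [FiniteDimensional K A] {g : A} (hg : IsGroupLikeElem K g) (hne : g ≠ 1) :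
    LinearMap.trace K A (LinearMap.mulLeft K g) = 0 := by
  obtain ⟨N, hN, hgN, hpow⟩ := hg.linearIndependent_pow hne
  have : NeZero N := ⟨by omega⟩
  have : Fact (1 < N) := ⟨hN⟩
  obtain ⟨ζ, f, a, -, hf, ha⟩ := exists_linearIndependent_pow_mul (K := K) hgN
  let b := Module.Basis.mk ha (span_pow_mul_eq_top hg hpow hf ha).ge
  have hb (i : ZMod N) (j : Fin f) : LinearMap.mulLeft K g (b (i, j)) = b (i + 1, j) := by
    simp [b, pow_val_add_one hgN, ← mul_assoc, ← pow_succ, ← pow_succ']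
  rw [LinearMap.trace_eq_matrix_trace K b, Matrix.trace]
  refine Finset.sum_eq_zero fun p _ ↦ ?_
  obtain ⟨i, j⟩ := p
  rw [Matrix.diag_apply, LinearMap.toMatrix_apply, hb, b.repr_self, Finsupp.single_apply,
    if_neg (by simp)]

end Hopf

/-- If `g` is a non-trivial grouplike element of a finite-dimensional Hopf algebra `A`
over a field `k`, then the trace of left multiplication by `g` on `A` is zero. -/
theorem trace_mulLeft_grouplike_eq_zero (k : Type*) [Field k] (A : Type*) [Ring A]
    [HopfAlgebra k A] [FiniteDimensional k A] (g : A)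
    (hg : Coalgebra.comul (R := k) g = g ⊗ₜ[k] g)
    (hcounit : Coalgebra.counit (R := k) g = (1 : k)) (hne : g ≠ 1) :
    LinearMap.trace k A (LinearMap.mulLeft k g) = 0 := by
  let K := AlgebraicClosure k
  have hgK : IsGroupLikeElem K ((1 : K) ⊗ₜ[k] g) :=
    ⟨by simp [TensorProduct.counit_tmul, hcounit], by
      rw [TensorProduct.comul_tmul, hg, CommSemiring.comul_apply]
      rfl⟩
  have hneK : (1 : K) ⊗ₜ[k] g ≠ 1 := fun h ↦
    hne (Algebra.TensorProduct.includeRight_injective (algebraMap k K).injective h)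
  have hbase : LinearMap.mulLeft K ((1 : K) ⊗ₜ[k] g) = (LinearMap.mulLeft k g).baseChange K := by
    ext a
    simp
  have h0 := hgK.trace_mulLeft_eq_zero_of_isAlgClosed hneK
  rw [hbase, LinearMap.trace_baseChange] at h0
  exact (map_eq_zero_iff _ (algebraMap k K).injective).1 h0
end

section
/- Let A be a finite-dimensional Hopf algebra over a field k with char(k) not dividing dim(A), and let u be a grouplike element of A such that for the left regular representation, tr(a ↦ ua) = dim(A). Then u = 1. -/
open TensorProduct

/-- The linear maps `T : V → W` with range in `P` that satisfy `g ∘ T ∘ f = μ • T`. -/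
def twistedHom {K V W : Type*} [Field K] [AddCommGroup V] [Module K V] [AddCommGroup W]
    [Module K W] (P : Submodule K W) (g : W →ₗ[K] W) (f : V →ₗ[K] V) (μ : K) :
    Submodule K (V →ₗ[K] W) where
  carrier := {T | (∀ v, g (T (f v)) = μ • T v) ∧ ∀ v, T v ∈ P}
  add_mem' := fun {S T} hS hT =>
    ⟨fun v => by simp [hS.1, hT.1], fun v => P.add_mem (hS.2 v) (hT.2 v)⟩
  zero_mem' := by simp
  smul_mem' := fun c T hT =>
    ⟨fun v => by simp [hT.1, smul_comm c μ], fun v => P.smul_mem c (hT.2 v)⟩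

section LinearAlgebra

variable {K V W : Type*} [Field K] [AddCommGroup V] [Module K V] [AddCommGroup W] [Module K W]

theorem mem_twistedHom {P : Submodule K W} {g : W →ₗ[K] W} {f : V →ₗ[K] V} {μ : K}
    {T : V →ₗ[K] W} :
    T ∈ twistedHom P g f μ ↔ (∀ v, g (T (f v)) = μ • T v) ∧ ∀ v, T v ∈ P :=
  Iff.rfl

/-- Rank-nullity for a linear map restricted to a subspace. -/
theorem finrank_le_finrank_add_finrank_of_mapsTo {U X : Type*} [AddCommGroup U] [Module K U]
    [FiniteDimensional K U] [AddCommGroup X] [Module K X] [FiniteDimensional K X]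
    (S : Submodule K U) (φ : U →ₗ[K] X) (Q : Submodule K X) (N : Submodule K U)
    (hQ : ∀ x ∈ S, φ x ∈ Q) (hN : ∀ x ∈ S, φ x = 0 → x ∈ N) :
    Module.finrank K S ≤ Module.finrank K Q + Module.finrank K N := by
  have h := (φ.domRestrict S).finrank_range_add_finrank_ker
  have h1 : Module.finrank K (LinearMap.range (φ.domRestrict S)) ≤ Module.finrank K Q := by
    apply Submodule.finrank_mono
    rintro _ ⟨x, rfl⟩
    exact hQ _ x.2
  have h2 : Module.finrank K (LinearMap.ker (φ.domRestrict S)) ≤ Module.finrank K N := by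
    rw [← Submodule.finrank_map_subtype_eq S (LinearMap.ker (φ.domRestrict S))]
    apply Submodule.finrank_mono
    rintro _ ⟨x, hx, rfl⟩
    exact hN _ x.2 hx
  omega

theorem finrank_twistedHom_le_quotient [FiniteDimensional K V] [FiniteDimensional K W]
    (P : Submodule K W) (g : W →ₗ[K] W) (f : V →ₗ[K] V) (μ l : K) {v : V} (hv : f v = l • v)
    (hf : K ∙ v ≤ (K ∙ v).comap f) :
    Module.finrank K (twistedHom P g f μ) ≤
      Module.finrank K ↥(P ⊓ LinearMap.ker (l • g - μ • LinearMap.id)) +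
        Module.finrank K (twistedHom P g ((K ∙ v).mapQ (K ∙ v) f hf) μ) := by
  have key := finrank_le_finrank_add_finrank_of_mapsTo (twistedHom P g f μ)
    (LinearMap.applyₗ v) (P ⊓ LinearMap.ker (l • g - μ • LinearMap.id))
    ((twistedHom P g ((K ∙ v).mapQ (K ∙ v) f hf) μ).map (LinearMap.lcomp K W (K ∙ v).mkQ))
    (by
      intro T hT
      refine ⟨hT.2 v, ?_⟩
      have := hT.1 v
      rw [hv] at this
      simpa [sub_eq_zero] using this)
    (by
      intro T hT hTv
      refine ⟨(K ∙ v).liftQ T ?_, ⟨?_, ?_⟩, ?_⟩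
      · rw [Submodule.span_singleton_le_iff_mem]
        exact hTv
      · intro x
        obtain ⟨x, rfl⟩ := (K ∙ v).mkQ_surjective x
        simpa using hT.1 x
      · intro x
        obtain ⟨x, rfl⟩ := (K ∙ v).mkQ_surjective x
        simpa using hT.2 x
      · ext x
        simp)
  exact key.trans (Nat.add_le_add_left (Submodule.finrank_map_le _ _) _)

theorem trace_eq_add_trace_mapQ [FiniteDimensional K V] (f : V →ₗ[K] V) (l : K) {v : V}
    (hv0 : v ≠ 0) (hv : f v = l • v) (hf : K ∙ v ≤ (K ∙ v).comap f) :
    LinearMap.trace K V f =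
      l + LinearMap.trace K _ ((K ∙ v).mapQ (K ∙ v) f hf) := by
  obtain ⟨φ, hφ⟩ := Module.Projective.exists_dual_eq_one K hv0
  have hle : K ∙ v ≤ LinearMap.ker (LinearMap.id - φ.smulRight v) := by
    rw [Submodule.span_singleton_le_iff_mem, LinearMap.mem_ker]
    simp [hφ]
  obtain ⟨s, hs'⟩ : ∃ s : (V ⧸ K ∙ v) →ₗ[K] V, ∀ x, s ((K ∙ v).mkQ x) = x - φ x • v :=
    ⟨(K ∙ v).liftQ _ hle, fun x => by simp⟩
  have hs : (K ∙ v).mkQ ∘ₗ s = LinearMap.id := by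
    apply Submodule.linearMap_qext
    ext x
    have : (K ∙ v).mkQ v = 0 := by simp
    simp only [LinearMap.comp_apply, hs', map_sub, map_smul, this, LinearMap.id_apply, smul_zero,
      sub_zero]
  have h1 : f = (f ∘ₗ s) ∘ₗ (K ∙ v).mkQ + φ.smulRight (l • v) := by
    ext x
    simp only [LinearMap.add_apply, LinearMap.comp_apply, hs', LinearMap.smulRight_apply, map_sub,
      map_smul, hv, sub_add_cancel]
  have h2 : (K ∙ v).mkQ ∘ₗ f ∘ₗ s = (K ∙ v).mapQ (K ∙ v) f hf := by
    rw [← LinearMap.comp_assoc, ← Submodule.mapQ_mkQ (K ∙ v) (K ∙ v) f, LinearMap.comp_assoc, hs,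
      LinearMap.comp_id]
  conv_lhs => rw [h1]
  rw [map_add, LinearMap.trace_comp_comm', h2, LinearMap.trace_smulRight]
  simp [hφ, add_comm]

theorem finrank_inf_ker_le_ite [DecidableEq K] (l μ : K) :
    Module.finrank K ↥((⊤ : Submodule K K) ⊓
      LinearMap.ker (l • (LinearMap.id : K →ₗ[K] K) - μ • LinearMap.id)) ≤
      if μ = l then 1 else 0 := by
  split_ifs with h
  · simpa using Submodule.finrank_le ((⊤ : Submodule K K) ⊓
      LinearMap.ker (l • (LinearMap.id : K →ₗ[K] K) - μ • LinearMap.id))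
  · rw [Nat.le_zero, Submodule.finrank_eq_zero, eq_bot_iff]
    rintro x ⟨-, hx⟩
    have hx' : l * x - μ * x = 0 := by simpa using hx
    rw [← sub_mul, mul_eq_zero, sub_eq_zero] at hx'
    exact hx'.resolve_left (Ne.symm h)

open Classical in
/-- The eigenvalues of `f` with algebraic multiplicity form a multiset `s` controlling the
dimension of each space of maps `T` with `g ∘ T ∘ f = μ • T`. -/
theorem exists_multiset_finrank_twistedHom_le [IsAlgClosed K] [FiniteDimensional K V]
    [FiniteDimensional K W] (f : V →ₗ[K] V) :
    ∃ s : Multiset K, s.card = Module.finrank K V ∧ s.sum = LinearMap.trace K V f ∧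
      (∀ μ, Module.finrank K (twistedHom (⊤ : Submodule K K) LinearMap.id f μ) ≤ s.count μ) ∧
      ∀ (P : Submodule K W) (g : W →ₗ[K] W) (μ : K), Module.finrank K (twistedHom P g f μ) ≤
        (s.map fun l => Module.finrank K
          ↥(P ⊓ LinearMap.ker (l • g - μ • LinearMap.id))).sum := by
  induction h : Module.finrank K V using Nat.strong_induction_on generalizing V with
  | _ n ih =>
  subst h
  rcases subsingleton_or_nontrivial V with hV | hV
  · refine ⟨0, by simp [Module.finrank_zero_of_subsingleton], ?_, ?_, ?_⟩
    · simp [Subsingleton.elim f 0]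
    · intro μ
      simp [Module.finrank_zero_of_subsingleton]
    · intro P g μ
      simp [Module.finrank_zero_of_subsingleton]
  · obtain ⟨l, hl⟩ := Module.End.exists_eigenvalue f
    obtain ⟨v, hv⟩ := hl.exists_hasEigenvector
    have hv0 : v ≠ 0 := hv.2
    have hfv : f v = l • v := hv.apply_eq_smul
    have hf : K ∙ v ≤ (K ∙ v).comap f := by
      rw [Submodule.span_singleton_le_iff_mem, Submodule.mem_comap, hfv]
      exact Submodule.smul_mem _ _ (Submodule.mem_span_singleton_self v)
    have hd : Module.finrank K (V ⧸ K ∙ v) + 1 = Module.finrank K V := by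
      rw [← finrank_span_singleton (K := K) hv0]
      exact Submodule.finrank_quotient_add_finrank _
    obtain ⟨s, hs, htr, hct, hT⟩ := ih _ (by omega) ((K ∙ v).mapQ (K ∙ v) f hf) rfl
    refine ⟨l ::ₘ s, by simp [hs, hd], ?_, ?_, ?_⟩
    · rw [Multiset.sum_cons, htr, trace_eq_add_trace_mapQ f l hv0 hfv hf]
    · intro μ
      rw [Multiset.count_cons, add_comm]
      exact (finrank_twistedHom_le_quotient _ _ f μ l hfv hf).trans
        (add_le_add (finrank_inf_ker_le_ite l μ) (hct μ))
    · intro P g μ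
      rw [Multiset.map_cons, Multiset.sum_cons]
      exact (finrank_twistedHom_le_quotient P g f μ l hfv hf).trans
        (Nat.add_le_add_left (hT P g μ) _)

theorem finrank_twistedHom_transpose_eq [FiniteDimensional K V] (g : V →ₗ[K] V) (μ : K) :
    Module.finrank K (twistedHom (⊤ : Submodule K K) LinearMap.id
      (Module.Dual.transpose (R := K) g) μ) =
      Module.finrank K (LinearMap.ker (g - μ • LinearMap.id)) := by
  have h : twistedHom (⊤ : Submodule K K) LinearMap.id (Module.Dual.transpose (R := K) g) μ =
      (LinearMap.ker (g - μ • LinearMap.id)).map (Module.evalEquiv K V).toLinearMap := by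
    ext h
    obtain ⟨x, rfl⟩ := (Module.evalEquiv K V).surjective h
    rw [Submodule.mem_map_equiv, LinearEquiv.symm_apply_apply, LinearMap.mem_ker,
      ← Module.forall_dual_apply_eq_zero_iff K, mem_twistedHom]
    simp [sub_eq_zero, Module.Dual.transpose_apply]
  rw [h]
  exact LinearEquiv.finrank_map_eq (Module.evalEquiv K V) _

end LinearAlgebra

section Hopf

open Coalgebra HopfAlgebra

variable {K A : Type*} [Field K] [Ring A] [HopfAlgebra K A]

/-- The map `a ⊗ b ↦ a₁ ⊗ a₂ b`. -/
noncomputable def comulMul (K A : Type*) [Field K] [Ring A] [HopfAlgebra K A] :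
    A ⊗[K] A →ₗ[K] A ⊗[K] A :=
  (LinearMap.mul' K A).lTensor A ∘ₗ (TensorProduct.assoc K A A A).toLinearMap ∘ₗ
    (comul (R := K) (A := A)).rTensor A

/-- The map `a ⊗ b ↦ a₁ ⊗ S(a₂) b`. -/
noncomputable def comulAntipodeMul (K A : Type*) [Field K] [Ring A] [HopfAlgebra K A] :
    A ⊗[K] A →ₗ[K] A ⊗[K] A :=
  (LinearMap.mul' K A ∘ₗ (antipode K).rTensor A).lTensor A ∘ₗ
    (TensorProduct.assoc K A A A).toLinearMap ∘ₗ (comul (R := K) (A := A)).rTensor A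

theorem comulMul_tmul (a b : A) :
    comulMul K A (a ⊗ₜ b) = comul (R := K) a * (1 ⊗ₜ b) := by
  simp only [comulMul, LinearMap.comp_apply, LinearMap.rTensor_tmul]
  induction comul (R := K) a using TensorProduct.induction_on with
  | zero => simp
  | tmul x y => simp
  | add x y hx hy => simp only [add_tmul, map_add, add_mul, hx, hy]

theorem comulAntipodeMul_mul (t : A ⊗[K] A) (b : A) :
    comulAntipodeMul K A (t * (1 ⊗ₜ b)) = comulAntipodeMul K A t * (1 ⊗ₜ b) := by
  induction t using TensorProduct.induction_on with
  | zero => simp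
  | tmul x y =>
    simp only [comulAntipodeMul, LinearMap.comp_apply, LinearMap.rTensor_tmul,
      Algebra.TensorProduct.tmul_mul_tmul, mul_one]
    induction comul (R := K) x using TensorProduct.induction_on with
    | zero => simp
    | tmul z w => simp [mul_assoc]
    | add z w hz hw => simp only [add_tmul, map_add, add_mul, hz, hw]
  | add x y hx hy => simp only [map_add, add_mul, hx, hy]

theorem comulAntipodeMul_comul (a : A) :
    comulAntipodeMul K A (comul (R := K) a) = a ⊗ₜ 1 := by
  simp only [comulAntipodeMul, LinearMap.comp_apply, LinearEquiv.coe_coe, coassoc_apply]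
  rw [← LinearMap.comp_apply, ← LinearMap.lTensor_comp, LinearMap.comp_assoc,
    mul_antipode_rTensor_comul, LinearMap.lTensor_comp, LinearMap.comp_apply,
    lTensor_counit_comul]
  simp

theorem comulMul_injective : Function.Injective (comulMul K A) := by
  have h : comulAntipodeMul K A ∘ₗ comulMul K A = LinearMap.id := by
    ext a b
    simp [comulMul_tmul, comulAntipodeMul_mul, comulAntipodeMul_comul]
  exact Function.LeftInverse.injective (g := comulAntipodeMul K A) (LinearMap.congr_fun h)

/-- The map sending `a ⊗ b` to `φ ↦ φ(b) a`. -/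
noncomputable def tensorContract (K A : Type*) [Field K] [Ring A] [Algebra K A] :
    A ⊗[K] A →ₗ[K] (Module.Dual K A →ₗ[K] A) :=
  TensorProduct.lift ((LinearMap.smulRightₗ ∘ₗ Module.Dual.eval K A).flip)

theorem tensorContract_tmul (a b : A) (φ : Module.Dual K A) :
    tensorContract K A (a ⊗ₜ b) φ = φ b • a := by
  simp [tensorContract]

theorem tensorContract_injective [FiniteDimensional K A] :
    Function.Injective (tensorContract K A) := by
  let b := Module.finBasis K A
  rw [injective_iff_map_eq_zero]
  intro t ht
  have h : ∀ t : A ⊗[K] A, t = ∑ i, tensorContract K A t (b.coord i) ⊗ₜ b i := by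
    intro t
    induction t using TensorProduct.induction_on with
    | zero => simp
    | tmul x y =>
      simp only [tensorContract_tmul, smul_tmul, ← tmul_sum]
      congr 1
      exact (b.sum_repr y).symm
    | add x y hx hy =>
      conv_lhs => rw [hx, hy]
      simp [add_tmul, Finset.sum_add_distrib]
  rw [h t, ht]
  simp

theorem mul_tensorContract_transpose (u : A) (t : A ⊗[K] A) (φ : Module.Dual K A) :
    u * tensorContract K A t (φ ∘ₗ LinearMap.mulLeft K u) =
      tensorContract K A ((u ⊗ₜ u) * t) φ := by
  induction t using TensorProduct.induction_on with
  | zero => simp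
  | tmul x y => simp [tensorContract_tmul]
  | add x y hx hy => simp only [map_add, mul_add, LinearMap.add_apply, hx, hy]

theorem finrank_ker_mul_finrank_le [FiniteDimensional K A] {u : A} (hu : IsGroupLikeElem K u)
    (μ : K) :
    Module.finrank K (LinearMap.ker (LinearMap.mulLeft K u - μ • LinearMap.id)) *
        Module.finrank K A ≤
      Module.finrank K (twistedHom (⊤ : Submodule K A) (LinearMap.mulLeft K u)
        (Module.Dual.transpose (R := K) (LinearMap.mulLeft K u)) μ) := by
  set E := LinearMap.ker (LinearMap.mulLeft K u - μ • LinearMap.id)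
  let F : E ⊗[K] A →ₗ[K] (Module.Dual K A →ₗ[K] A) :=
    tensorContract K A ∘ₗ comulMul K A ∘ₗ E.subtype.rTensor A
  have hF : Function.Injective F :=
    tensorContract_injective.comp (comulMul_injective.comp
      (Module.Flat.rTensor_preserves_injective_linearMap _ E.injective_subtype))
  rw [← Module.finrank_tensorProduct, ← LinearMap.finrank_range_of_inj hF]
  apply Submodule.finrank_mono
  rintro _ ⟨t, rfl⟩
  induction t using TensorProduct.induction_on with
  | zero => simp
  | add x y hx hy => rw [map_add]; exact Submodule.add_mem _ hx hy
  | tmul c b =>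
    refine mem_twistedHom.2 ⟨fun φ => ?_, fun _ => trivial⟩
    have hc : u * (c : A) = μ • (c : A) :=
      sub_eq_zero.1 (LinearMap.mem_ker.1 c.2)
    change u * tensorContract K A (comulMul K A ((c : A) ⊗ₜ b)) (φ ∘ₗ LinearMap.mulLeft K u) =
      μ • tensorContract K A (comulMul K A ((c : A) ⊗ₜ b)) φ
    rw [mul_tensorContract_transpose, comulMul_tmul, ← mul_assoc, ← hu.comul_eq_tmul_self,
      ← Bialgebra.comul_mul, hc]
    simp

/-- The linear functional on the dual of `A` given by the trace of the regular representation of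
the dual algebra is represented by an element `y` which is fixed by `u`. -/
theorem exists_mul_eq_self_counit_eq_finrank [FiniteDimensional K A] {u : A}
    (hu : IsGroupLikeElem K u) :
    ∃ y : A, u * y = y ∧ counit (R := K) y = (Module.finrank K A : K) := by
  let E : Module.Dual K A →ₗ[K] (A →ₗ[K] A) :=
    { toFun := fun φ => (TensorProduct.lid K A).toLinearMap ∘ₗ φ.rTensor A ∘ₗ comul
      map_add' := fun φ ψ => by ext; simp [LinearMap.rTensor_add]
      map_smul' := fun c φ => by ext; simp [LinearMap.rTensor_smul] }
  obtain ⟨y, hy⟩ := (Module.evalEquiv K A).surjective (LinearMap.trace K A ∘ₗ E)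
  have hy' : ∀ φ : Module.Dual K A, φ y = LinearMap.trace K A (E φ) := fun φ => by
    simpa using LinearMap.congr_fun hy φ
  refine ⟨y, ?_, ?_⟩
  · obtain ⟨v, rfl⟩ := hu.isUnit
    rw [← sub_eq_zero, ← Module.forall_dual_apply_eq_zero_iff K]
    intro φ
    have h : LinearMap.mulLeft K (v : A) ∘ₗ E (φ ∘ₗ LinearMap.mulLeft K (v : A)) =
        E φ ∘ₗ LinearMap.mulLeft K (v : A) := by
      ext a
      simp only [E, LinearMap.coe_mk, AddHom.coe_mk, LinearMap.comp_apply,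
        LinearMap.mulLeft_apply, Bialgebra.comul_mul, hu.comul_eq_tmul_self]
      induction comul (R := K) a using TensorProduct.induction_on with
      | zero => simp
      | tmul x y => simp
      | add x y hx hy => simp only [map_add, mul_add, hx, hy]
    have h' : E (φ ∘ₗ LinearMap.mulLeft K (v : A)) =
        (LinearMap.mulLeft K (↑v⁻¹ : A) ∘ₗ E φ) ∘ₗ LinearMap.mulLeft K (v : A) := by
      rw [LinearMap.comp_assoc, ← h]
      ext a
      simp
    rw [map_sub, sub_eq_zero, hy', ← LinearMap.mulLeft_apply (R := K), ← LinearMap.comp_apply, hy',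
      h', LinearMap.trace_comp_comm', ← LinearMap.comp_assoc]
    congr 1
    ext a
    simp
  · rw [hy']
    have : E counit = LinearMap.id := by
      ext a
      simp [E]
    rw [this, LinearMap.trace_id]

end Hopf

section Multiset

variable {α : Type*}

theorem Multiset.sum_map_add_count_le [DecidableEq α] (s : Multiset α) (F G : α → ℕ) (a : α)
    (h : ∀ l, F l + (if a = l then 1 else 0) ≤ G l) :
    (s.map F).sum + s.count a ≤ (s.map G).sum := by
  induction s using Multiset.induction_on with
  | empty => simp
  | cons l s ih =>
    have := h l
    simp only [Multiset.map_cons, Multiset.sum_cons, Multiset.count_cons]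
    omega

theorem Multiset.eq_of_card_mul_le_sum_map (s : Multiset α) (F : α → ℕ) (M : ℕ)
    (hF : ∀ l, F l ≤ M) (h : s.card * M ≤ (s.map F).sum) {l : α} (hl : l ∈ s) : F l = M := by
  obtain ⟨t, rfl⟩ := Multiset.exists_cons_of_mem hl
  have ht : (t.map F).sum ≤ t.card * M := by
    simpa using Multiset.sum_le_card_nsmul (t.map F) M (by simpa using fun a _ => hF a)
  have := hF l
  simp only [Multiset.card_cons, Multiset.map_cons, Multiset.sum_cons, add_mul, one_mul] at h
  omega

end Multiset

/-- A multiset of nonzero scalars that is closed under multiplication, with constant multiplicities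
and nonzero sum, contains only `1`. -/
theorem Multiset.eq_one_of_sum_ne_zero {K : Type*} [Field K] [DecidableEq K] (s : Multiset K)
    (M : ℕ) (hc : ∀ l ∈ s, s.count l = M) (h0 : ∀ l ∈ s, l ≠ 0)
    (hmul : ∀ l ∈ s, ∀ m ∈ s, l * m ∈ s) (hsum : s.sum ≠ 0) {l : K} (hl : l ∈ s) : l = 1 := by
  have hs : s.sum = M • ∑ m ∈ s.toFinset, m := by
    rw [Finset.sum_multiset_count, Finset.smul_sum]
    exact Finset.sum_congr rfl fun m hm => by rw [hc m (Multiset.mem_toFinset.1 hm)]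
  have himg : s.toFinset.image (l * ·) = s.toFinset := by
    apply Finset.eq_of_subset_of_card_le
    · intro m hm
      obtain ⟨x, hx, rfl⟩ := Finset.mem_image.1 hm
      exact Multiset.mem_toFinset.2 (hmul l hl x (Multiset.mem_toFinset.1 hx))
    · rw [Finset.card_image_of_injective _ (mul_right_injective₀ (h0 l hl))]
  have h1 : l * ∑ m ∈ s.toFinset, m = ∑ m ∈ s.toFinset, m := by
    conv_rhs => rw [← himg]
    rw [Finset.sum_image fun _ _ _ _ h => mul_right_injective₀ (h0 l hl) h, Finset.mul_sum]
  have h2 : ∑ m ∈ s.toFinset, m ≠ 0 := fun h => hsum (by rw [hs, h, smul_zero])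
  exact mul_right_cancel₀ h2 (h1.trans (one_mul _).symm)

section Main

open Coalgebra HopfAlgebra

variable {K A : Type*} [Field K] [Ring A] [HopfAlgebra K A] [FiniteDimensional K A]

theorem finrank_ker_counit_inf_add_le [DecidableEq K] {u y : A} (hy : u * y = y)
    (hy0 : counit (R := K) y ≠ 0) (l μ : K) :
    Module.finrank K ↥(LinearMap.ker (counit (R := K) (A := A)) ⊓
        LinearMap.ker (l • LinearMap.mulLeft K u - μ • LinearMap.id)) +
      (if μ = l then 1 else 0) ≤
    Module.finrank K (LinearMap.ker (l • LinearMap.mulLeft K u - μ • LinearMap.id)) := by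
  split_ifs with h
  · subst h
    apply Submodule.finrank_lt_finrank_of_lt
    refine lt_of_le_of_ne inf_le_right fun h => hy0 ?_
    have hm : y ∈ LinearMap.ker (μ • LinearMap.mulLeft K u - μ • LinearMap.id) := by
      simp [hy]
    rw [← h] at hm
    exact hm.1
  · exact Submodule.finrank_mono inf_le_right

theorem finrank_mul_finrank_ker_le [DecidableEq K] {u : A} (hu : IsGroupLikeElem K u)
    (hdim : (Module.finrank K A : K) ≠ 0) (s : Multiset K)
    (hs : ∀ (P : Submodule K A) (g : A →ₗ[K] A) (μ : K),
      Module.finrank K (twistedHom P g (Module.Dual.transpose (R := K) (LinearMap.mulLeft K u)) μ) ≤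
        (s.map fun l => Module.finrank K
          ↥(P ⊓ LinearMap.ker (l • g - μ • LinearMap.id))).sum) (μ : K) :
    Module.finrank K (LinearMap.ker (LinearMap.mulLeft K u - μ • LinearMap.id)) *
        Module.finrank K A + s.count μ ≤
      Module.finrank K (LinearMap.ker (LinearMap.mulLeft K u - μ • LinearMap.id)) +
        (s.map fun l => Module.finrank K
          (LinearMap.ker (l • LinearMap.mulLeft K u - μ • LinearMap.id))).sum := by
  obtain ⟨y, hy, hy0⟩ := exists_mul_eq_self_counit_eq_finrank hu
  have h1 := finrank_ker_mul_finrank_le hu μ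
  have h2 := finrank_le_finrank_add_finrank_of_mapsTo
    (twistedHom (⊤ : Submodule K A) (LinearMap.mulLeft K u)
      (Module.Dual.transpose (R := K) (LinearMap.mulLeft K u)) μ)
    (LinearMap.compRight K (M := Module.Dual K A) (counit (R := K) (A := A)))
    (twistedHom (⊤ : Submodule K K) LinearMap.id
      (Module.Dual.transpose (R := K) (LinearMap.mulLeft K u)) μ)
    (twistedHom (LinearMap.ker (counit (R := K) (A := A))) (LinearMap.mulLeft K u)
      (Module.Dual.transpose (R := K) (LinearMap.mulLeft K u)) μ)
    (fun T hT => mem_twistedHom.2 ⟨fun φ => by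
      have := congrArg (counit (R := K)) (hT.1 φ)
      simpa [hu.counit_eq_one] using this, fun _ => trivial⟩)
    (fun T hT h => mem_twistedHom.2 ⟨hT.1, fun φ => LinearMap.congr_fun h φ⟩)
  rw [finrank_twistedHom_transpose_eq] at h2
  have h3 := hs (LinearMap.ker (counit (R := K) (A := A))) (LinearMap.mulLeft K u) μ
  have h4 := s.sum_map_add_count_le _ _ μ
    (finrank_ker_counit_inf_add_le hy (hy0 ▸ hdim) · μ)
  omega

theorem IsGroupLikeElem.eq_one_of_trace_eq_finrank [IsAlgClosed K] {u : A}
    (hu : IsGroupLikeElem K u) (hdim : (Module.finrank K A : K) ≠ 0)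
    (htr : LinearMap.trace K A (LinearMap.mulLeft K u) = (Module.finrank K A : K)) : u = 1 := by
  classical
  obtain ⟨s, hcard, hsum, hcount, hs⟩ := exists_multiset_finrank_twistedHom_le (W := A)
    (Module.Dual.transpose (R := K) (LinearMap.mulLeft K u))
  rw [Subspace.dual_finrank_eq] at hcard
  rw [LinearMap.trace_transpose', htr] at hsum
  have key := finrank_mul_finrank_ker_le hu hdim s hs
  simp only [finrank_twistedHom_transpose_eq] at hcount
  set n : K → ℕ := fun μ =>
    Module.finrank K (LinearMap.ker (LinearMap.mulLeft K u - μ • LinearMap.id)) with hn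
  have : Nontrivial A := Module.nontrivial_of_finrank_pos (R := K)
    (Nat.pos_of_ne_zero fun h => hdim (by simp [h]))
  obtain ⟨μ₀, hmax⟩ : ∃ μ₀, ∀ μ, n μ ≤ n μ₀ := by
    have hb : BddAbove (Set.range n) :=
      ⟨Module.finrank K A, by rintro _ ⟨μ, rfl⟩; exact Submodule.finrank_le _⟩
    obtain ⟨μ₀, h⟩ := Nat.sSup_mem (Set.range_nonempty n) hb
    exact ⟨μ₀, fun μ => h ▸ le_csSup hb ⟨μ, rfl⟩⟩
  set M := n μ₀ with hM
  have hn0 : n 0 = 0 := by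
    simp only [hn, zero_smul, sub_zero, Submodule.finrank_eq_zero]
    exact LinearMap.ker_eq_bot.2 hu.isUnit.mul_right_injective
  have hMpos : 0 < M := by
    obtain ⟨l, hl⟩ := Module.End.exists_eigenvalue (LinearMap.mulLeft K u)
    obtain ⟨v, hv⟩ := hl.exists_hasEigenvector
    refine lt_of_lt_of_le ?_ (hmax l)
    refine Module.finrank_pos_iff_exists_ne_zero.2 ⟨⟨v, ?_⟩, fun h => hv.2 (congrArg Subtype.val h)⟩
    rw [LinearMap.mem_ker, LinearMap.sub_apply, hv.apply_eq_smul]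
    simp
  have hN : ∀ l μ : K, μ ≠ 0 → Module.finrank K
      (LinearMap.ker (l • LinearMap.mulLeft K u - μ • LinearMap.id)) =
      if l = 0 then 0 else n (μ / l) := by
    intro l μ hμ
    split_ifs with hl
    · rw [Submodule.finrank_eq_zero, LinearMap.ker_eq_bot']
      intro x hx
      simpa [hl, hμ] using hx
    · simp only [hn]
      rw [← LinearMap.ker_smul (LinearMap.mulLeft K u - (μ / l) • LinearMap.id) l hl,
        smul_sub, smul_smul, mul_div_cancel₀ _ hl]
  have hmain : ∀ μ, n μ = M → s.count μ = M ∧ ∀ l ∈ s, l ≠ 0 ∧ n (μ / l) = M := by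
    intro μ hμ
    have hμ0 : μ ≠ 0 := by rintro rfl; omega
    have hle : ∀ l, (if l = 0 then 0 else n (μ / l)) ≤ M := fun l => by
      split_ifs
      · exact Nat.zero_le _
      · exact hmax _
    have hk := key μ
    simp only [hN _ μ hμ0] at hk
    have hub : (s.map fun l => if l = 0 then 0 else n (μ / l)).sum ≤ s.card * M := by
      simpa using Multiset.sum_le_card_nsmul (s.map fun l => if l = 0 then 0 else n (μ / l)) M
        (by
          intro a ha
          obtain ⟨l, -, rfl⟩ := Multiset.mem_map.1 ha
          exact hle l)
    have hc := hcount μ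
    change n μ * _ + _ ≤ n μ + _ at hk
    change n μ ≤ _ at hc
    rw [hμ, mul_comm, ← hcard] at hk
    rw [hμ] at hc
    refine ⟨by omega, fun l hl => ?_⟩
    have := s.eq_of_card_mul_le_sum_map _ M hle (by omega) hl
    split_ifs at this with h0
    · omega
    · exact ⟨h0, this⟩
  have hmem : ∀ μ, n μ = M → μ ∈ s := fun μ hμ =>
    Multiset.count_pos.1 (by rw [(hmain μ hμ).1]; exact hMpos)
  have h1 : n 1 = M := by
    have := (hmain μ₀ rfl).2 μ₀ (hmem μ₀ rfl)
    rw [div_self this.1] at this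
    exact this.2
  have hinv : ∀ l ∈ s, n l⁻¹ = M := fun l hl => by
    simpa using ((hmain 1 h1).2 l hl).2
  have hself : ∀ l ∈ s, n l = M := fun l hl => by
    simpa using hinv _ (hmem _ (hinv l hl))
  have hall : ∀ l ∈ s, l = 1 := fun l hl =>
    s.eq_one_of_sum_ne_zero M (fun l hl => (hmain l (hself l hl)).1)
      (fun l hl => ((hmain 1 h1).2 l hl).1)
      (fun l hl m hm => by
        have := ((hmain l (hself l hl)).2 _ (hmem _ (hinv m hm))).2
        rw [div_inv_eq_mul] at this
        exact hmem _ this)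
      (hsum ▸ hdim) hl
  have hfull : n 1 = Module.finrank K A := by
    rw [h1, ← (hmain 1 h1).1, ← hcard]
    exact Multiset.count_eq_card.2 fun l hl => (hall l hl).symm
  have htop := Submodule.eq_top_of_finrank_eq hfull
  have := LinearMap.mem_ker.1 (htop ▸ Submodule.mem_top : (1 : A) ∈ _)
  simpa [sub_eq_zero] using this

end Main

/-- Let `A` be a finite-dimensional Hopf algebra over `k` with `char k` not dividing
`dim A`, and let `u` be a grouplike element of `A` whose left multiplication on `A` has
trace `dim A`. Then `u = 1`. -/
theorem grouplike_of_trace_eq_dim (k : Type*) [Field k] (A : Type*) [Ring A]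
    [HopfAlgebra k A] [FiniteDimensional k A] (u : A)
    (hg : Coalgebra.comul (R := k) u = u ⊗ₜ[k] u)
    (hcounit : Coalgebra.counit (R := k) u = (1 : k))
    (hdim : (Module.finrank k A : k) ≠ 0)
    (htr : LinearMap.trace k A (LinearMap.mulLeft k u) = (Module.finrank k A : k)) :
    u = 1 := by
  let K := AlgebraicClosure k
  have hu : IsGroupLikeElem K ((1 : K) ⊗ₜ[k] u) :=
    ⟨by simp [TensorProduct.counit_tmul, hcounit], by simp [TensorProduct.comul_tmul, hg]⟩
  have hfin : Module.finrank K (K ⊗[k] A) = Module.finrank k A := Module.finrank_baseChange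
  have hmul : LinearMap.mulLeft K ((1 : K) ⊗ₜ[k] u) = (LinearMap.mulLeft k u).baseChange K := by
    ext
    simp
  have h := hu.eq_one_of_trace_eq_finrank
    (by
      rw [hfin, ← map_natCast (algebraMap k K)]
      exact (map_ne_zero _).2 hdim)
    (by rw [hmul, LinearMap.trace_baseChange, htr, hfin, map_natCast])
  exact Algebra.TensorProduct.includeRight_injective (R := k) (A := K) (B := A)
    (algebraMap k K).injective (h.trans (map_one Algebra.TensorProduct.includeRight).symm)
end
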